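/- arXiv:2505.22629 — 2 statements merged into one kernel-verified Lean document; each statement's English description precedes it below -/
import Mathlib

section
/- Let D be a generalized depolarizing map on n qubits, i.e., D(ρ) = 2^{−n} Σ_a d(supp(a)) P_a tr(P_a ρ) for some function d from subsets of {1,…,n} to ℂ (its Pauli eigenvalues depend only on the support of the Pauli string). Then D commutes with conjugation by any tensor product of single-qubit unitaries: for every unitary U = U_1 ⊗ ⋯ ⊗ U_n with each U_i a 2×2 unitary and every 2^n×2^n matrix ρ, D(U ρ U†) = U D(ρ) U†. -/
open Matrix Finset

noncomputable section

/-- The four single-qubit Pauli matrices: `σ₀ = I`, `σ₁ = X`, `σ₂ = Y`, `σ₃ = Z`. -/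
def pauli1 : Fin 4 → Matrix (Fin 2) (Fin 2) ℂ
  | 0 => 1
  | 1 => !![0, 1; 1, 0]
  | 2 => !![0, -Complex.I; Complex.I, 0]
  | 3 => !![1, 0; 0, -1]

/-- The `n`-qubit Pauli matrix `P_a = σ_{a 1} ⊗ ⋯ ⊗ σ_{a n}` (Kronecker product realized
as a matrix indexed by `Fin n → Fin 2`). -/
def PauliMat (n : ℕ) (a : Fin n → Fin 4) :
    Matrix (Fin n → Fin 2) (Fin n → Fin 2) ℂ :=
  fun x y => ∏ i, pauli1 (a i) (x i) (y i)

/-- The symplectic pairing `⟨a,b⟩`: the parity of the number of sites where the two Pauli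
strings are both nontrivial and differ (so that `P_a P_b = (-1)^⟨a,b⟩ P_b P_a`).
The value is the parity, an element of `{0,1}`. -/
def pairing {n : ℕ} (a b : Fin n → Fin 4) : ℕ :=
  (Finset.univ.filter fun i => a i ≠ 0 ∧ b i ≠ 0 ∧ a i ≠ b i).card % 2

/-- The Pauli-diagonal map `Λ(ρ) = Σ_a c_a P_a ρ P_a`. -/
def pauliDiag (n : ℕ) (c : (Fin n → Fin 4) → ℂ) :
    Matrix (Fin n → Fin 2) (Fin n → Fin 2) ℂ → Matrix (Fin n → Fin 2) (Fin n → Fin 2) ℂ :=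
  fun ρ => ∑ a, c a • (PauliMat n a * ρ * PauliMat n a)

/-- The support of a Pauli string: the set of sites where it is nontrivial. -/
def psupp {n : ℕ} (a : Fin n → Fin 4) : Finset (Fin n) :=
  Finset.univ.filter fun i => a i ≠ 0

/-- The generalized depolarizing map
`D(ρ) = 2^{−n} Σ_a d(supp(a)) P_a tr(P_a ρ)`, whose Pauli eigenvalues depend only on the
support of the Pauli string. -/
def genDepol (n : ℕ) (d : Finset (Fin n) → ℂ) :
    Matrix (Fin n → Fin 2) (Fin n → Fin 2) ℂ → Matrix (Fin n → Fin 2) (Fin n → Fin 2) ℂ :=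
  fun ρ => ((2 : ℂ) ^ n)⁻¹ •
    ∑ a : Fin n → Fin 4, (d (psupp a) * Matrix.trace (PauliMat n a * ρ)) • PauliMat n a

/-- The tensor product `U₁ ⊗ ⋯ ⊗ Uₙ` of single-qubit matrices, as a matrix indexed by
`Fin n → Fin 2`. -/
def tensorMat (n : ℕ) (U : Fin n → Matrix (Fin 2) (Fin 2) ℂ) :
    Matrix (Fin n → Fin 2) (Fin n → Fin 2) ℂ :=
  fun x y => ∏ i, U i (x i) (y i)

theorem pauli1_zero : pauli1 0 = 1 := rfl

theorem tensorMat_mul (n : ℕ) (A B : Fin n → Matrix (Fin 2) (Fin 2) ℂ) :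
    tensorMat n A * tensorMat n B = tensorMat n fun i => A i * B i := by
  ext x y
  simp only [tensorMat, Matrix.mul_apply, ← Finset.prod_mul_distrib]
  rw [Finset.prod_univ_sum, Fintype.piFinset_univ]

theorem tensorMat_conjTranspose (n : ℕ) (A : Fin n → Matrix (Fin 2) (Fin 2) ℂ) :
    (tensorMat n A)ᴴ = tensorMat n fun i => (A i)ᴴ := by
  ext x y
  simp [tensorMat, Matrix.conjTranspose_apply]

theorem pauliMat_eq_tensorMat (n : ℕ) (a : Fin n → Fin 4) :
    PauliMat n a = tensorMat n fun i => pauli1 (a i) := rfl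

/-- A sum over Pauli strings weighted by a function of the support factorizes over the sites
once the support is fixed. -/
theorem sum_psupp_mul_prod (n : ℕ) (d : Finset (Fin n) → ℂ) (f : Fin n → Fin 4 → ℂ) :
    ∑ a : Fin n → Fin 4, d (psupp a) * ∏ i, f i (a i) =
      ∑ S : Finset (Fin n), d S *
        ∏ i, if i ∈ S then ∑ k ∈ ({0}ᶜ : Finset (Fin 4)), f i k else f i 0 := by
  rw [← Finset.sum_fiberwise (s := Finset.univ) (g := fun a : Fin n → Fin 4 => psupp a)]
  refine Finset.sum_congr rfl fun S _ => ?_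
  have hfiber : (Finset.univ.filter fun a : Fin n → Fin 4 => psupp a = S) =
      Fintype.piFinset fun i => if i ∈ S then ({0}ᶜ : Finset (Fin 4)) else {0} := by
    ext a
    simp only [Finset.mem_filter, Finset.mem_univ, true_and, Fintype.mem_piFinset, psupp,
      Finset.ext_iff]
    refine forall_congr' fun i => ?_
    by_cases hi : i ∈ S <;> simp [hi]
  have hsite (i : Fin n) :
      (if i ∈ S then ∑ k ∈ ({0}ᶜ : Finset (Fin 4)), f i k else f i 0) =
        ∑ k ∈ (if i ∈ S then ({0}ᶜ : Finset (Fin 4)) else {0}), f i k := by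
    split_ifs <;> simp
  simp only [hsite]
  rw [Finset.prod_univ_sum, ← hfiber, Finset.mul_sum]
  refine Finset.sum_congr rfl fun a ha => ?_
  rw [(Finset.mem_filter.mp ha).2]

/-- The completeness relation for the single-qubit Pauli matrices. -/
theorem sum_pauli1_mul_pauli1 (x y z w : Fin 2) :
    ∑ k, pauli1 k x y * pauli1 k z w = if x = w ∧ y = z then 2 else 0 := by
  fin_cases x <;> fin_cases y <;> fin_cases z <;> fin_cases w <;>
    norm_num [Fin.sum_univ_four, pauli1]

theorem sum_conj_pauli1_mul_pauli1 (A B : Matrix (Fin 2) (Fin 2) ℂ) (x y z w : Fin 2) :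
    ∑ k, (A * pauli1 k * B) x y * pauli1 k z w = 2 * (A x w * B z y) := by
  have h (k : Fin 4) : (A * pauli1 k * B) x y * pauli1 k z w =
      ∑ q, ∑ p, A x p * B q y * (pauli1 k p q * pauli1 k z w) := by
    simp only [Matrix.mul_apply, Finset.sum_mul]
    exact Finset.sum_congr rfl fun q _ => Finset.sum_congr rfl fun p _ => by ring
  simp only [h]
  rw [Finset.sum_comm]
  simp only [Finset.sum_comm (s := (Finset.univ : Finset (Fin 4))), ← Finset.mul_sum,
    sum_pauli1_mul_pauli1]
  fin_cases z <;> fin_cases w <;> simp [Fin.sum_univ_two] <;> ring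

/-- Conjugation of one tensor factor of `∑ₖ≠₀ σₖ ⊗ σₖ` by a unitary can be moved to the other. -/
theorem sum_compl_conj_pauli1 (V : Matrix (Fin 2) (Fin 2) ℂ)
    (h₁ : V * Vᴴ = 1) (h₂ : Vᴴ * V = 1) (x y z w : Fin 2) :
    ∑ k ∈ ({0}ᶜ : Finset (Fin 4)), (Vᴴ * pauli1 k * V) x y * pauli1 k z w =
      ∑ k ∈ ({0}ᶜ : Finset (Fin 4)), pauli1 k x y * (V * pauli1 k * Vᴴ) z w := by
  have hl := Finset.sum_add_sum_compl ({0} : Finset (Fin 4))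
    fun k => (Vᴴ * pauli1 k * V) x y * pauli1 k z w
  have hr := Finset.sum_add_sum_compl ({0} : Finset (Fin 4))
    fun k => pauli1 k x y * (V * pauli1 k * Vᴴ) z w
  have hr' := sum_conj_pauli1_mul_pauli1 V Vᴴ z w x y
  simp only [mul_comm _ (pauli1 _ x y)] at hr'
  rw [sum_conj_pauli1_mul_pauli1] at hl
  rw [hr'] at hr
  simp only [Finset.sum_singleton, pauli1_zero, Matrix.mul_one, h₁, h₂] at hl hr
  linear_combination hl - hr

theorem sum_trace_mul_smul_apply {α m : Type*} [Fintype α] [Fintype m] (c : α → ℂ)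
    (M N : α → Matrix m m ℂ) (ρ : Matrix m m ℂ) (z w : m) :
    (∑ a, (c a * Matrix.trace (M a * ρ)) • N a) z w =
      ∑ x, ∑ y, ρ y x * ∑ a, c a * (M a x y * N a z w) := by
  simp only [Matrix.sum_apply, Matrix.smul_apply, smul_eq_mul, Matrix.trace, Matrix.diag_apply,
    Matrix.mul_apply, Finset.mul_sum, Finset.sum_mul]
  rw [Finset.sum_comm]
  refine Finset.sum_congr rfl fun x _ => ?_
  rw [Finset.sum_comm]
  exact Finset.sum_congr rfl fun y _ => Finset.sum_congr rfl fun a _ => by ring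

theorem sum_psupp_conj_pauliMat (n : ℕ) (d : Finset (Fin n) → ℂ)
    (U : Fin n → Matrix (Fin 2) (Fin 2) ℂ)
    (hU : ∀ i, U i * (U i)ᴴ = 1 ∧ (U i)ᴴ * U i = 1) (x y z w : Fin n → Fin 2) :
    ∑ a, d (psupp a) *
        (((tensorMat n U)ᴴ * PauliMat n a * tensorMat n U) x y * PauliMat n a z w) =
      ∑ a, d (psupp a) *
        (PauliMat n a x y * (tensorMat n U * PauliMat n a * (tensorMat n U)ᴴ) z w) := by
  simp only [pauliMat_eq_tensorMat, tensorMat_conjTranspose, tensorMat_mul]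
  simp only [tensorMat, ← Finset.prod_mul_distrib]
  rw [sum_psupp_mul_prod n d fun i k =>
      ((U i)ᴴ * pauli1 k * U i) (x i) (y i) * pauli1 k (z i) (w i),
    sum_psupp_mul_prod n d fun i k =>
      pauli1 k (x i) (y i) * (U i * pauli1 k * (U i)ᴴ) (z i) (w i)]
  refine Finset.sum_congr rfl fun S _ => congrArg _ (Finset.prod_congr rfl fun i _ => ?_)
  simp only [sum_compl_conj_pauli1 (U i) (hU i).1 (hU i).2, pauli1_zero, Matrix.mul_one, hU i]

/-- A generalized depolarizing map commutes with conjugation by any tensor product of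
single-qubit unitaries: `D(U ρ U†) = U D(ρ) U†`. -/
theorem genDepol_comm_localUnitary (n : ℕ) (d : Finset (Fin n) → ℂ)
    (U : Fin n → Matrix (Fin 2) (Fin 2) ℂ)
    (hU : ∀ i, U i * (U i)ᴴ = 1 ∧ (U i)ᴴ * U i = 1) :
    ∀ ρ : Matrix (Fin n → Fin 2) (Fin n → Fin 2) ℂ,
      genDepol n d (tensorMat n U * ρ * (tensorMat n U)ᴴ) =
        tensorMat n U * genDepol n d ρ * (tensorMat n U)ᴴ := by
  intro ρ
  have htrace (a : Fin n → Fin 4) :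
      Matrix.trace (PauliMat n a * (tensorMat n U * ρ * (tensorMat n U)ᴴ)) =
        Matrix.trace ((tensorMat n U)ᴴ * PauliMat n a * tensorMat n U * ρ) := by
    rw [← Matrix.mul_assoc, Matrix.trace_mul_comm]
    simp only [Matrix.mul_assoc]
  simp only [genDepol, Matrix.mul_smul, Matrix.smul_mul, Matrix.mul_sum, Matrix.sum_mul, htrace]
  refine congrArg _ (Matrix.ext fun z w => ?_)
  rw [sum_trace_mul_smul_apply _ (fun a => (tensorMat n U)ᴴ * PauliMat n a * tensorMat n U),
    sum_trace_mul_smul_apply]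
  simp only [sum_psupp_conj_pauliMat n d U hU]

end
end

section
/- (Gauge invariance of all experiments.) Let Λ_S, Λ_M, Λ_1, …, Λ_T be Pauli-diagonal maps on n qubits, let G_1,…,G_T and U_1,…,U_T be 2^n×2^n unitaries with conjugation channels 𝒢_t(ρ)=G_tρG_t† and 𝒰_t(ρ)=U_tρU_t†, and let D be an invertible Pauli-diagonal map that commutes with each 𝒰_t. Define the gauge-transformed noise channels Λ_{S,η} = D∘Λ_S, Λ_{M,η} = Λ_M∘D^{−1}, and Λ_{t,η} = (𝒢_t^{−1}∘D∘𝒢_t)∘Λ_t∘D^{−1}. Then for every observable O and every state ρ₀ (arbitrary 2^n×2^n matrices), tr(O · Λ_{M,η}(𝒢_T(Λ_{T,η}(𝒰_T(⋯ 𝒢_1(Λ_{1,η}(𝒰_1(Λ_{S,η}(ρ₀)))) ⋯))))) = tr(O · Λ_M(𝒢_T(Λ_T(𝒰_T(⋯ 𝒢_1(Λ_1(𝒰_1(Λ_S(ρ₀)))) ⋯))))); i.e., the gauge transformation of Eq. (4) preserves every experimental expectation value. -/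
open Matrix Finset

noncomputable section

/-- Conjugation channel `ρ ↦ U ρ U†` of a unitary `U`. -/
def conjAct {m : Type*} [Fintype m] (U : Matrix m m ℂ) (ρ : Matrix m m ℂ) : Matrix m m ℂ :=
  U * ρ * Uᴴ

/-- Conjugation `𝒫_a : ρ ↦ P_a ρ P_a` by a Pauli matrix. -/
def pconj (n : ℕ) (a : Fin n → Fin 4) (ρ : Matrix (Fin n → Fin 2) (Fin n → Fin 2) ℂ) :
    Matrix (Fin n → Fin 2) (Fin n → Fin 2) ℂ :=
  PauliMat n a * ρ * PauliMat n a

/-- Run a `T`-layer circuit: apply `step 0`, then `step 1`, …, then `step (T-1)`. -/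
def runCirc {M : Type*} (T : ℕ) (step : Fin T → M → M) (ρ : M) : M :=
  (List.ofFn step).foldl (fun σ f => f σ) ρ

/-- A map intertwining the layers of two circuits intertwines the circuits. -/
theorem runCirc_semiconj {M N : Type*} (T : ℕ) (f : M → N) (g : Fin T → M → M)
    (h : Fin T → N → N) (hfg : ∀ t x, h t (f x) = f (g t x)) (x : M) :
    runCirc T h (f x) = f (runCirc T g x) := by
  unfold runCirc
  induction T generalizing x with
  | zero => simp
  | succ T ih =>
    simp only [List.ofFn_succ, List.foldl_cons, hfg]
    exact ih _ _ (fun t => hfg t.succ) _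

/-- For unitary `U`, conjugation by `U` undoes conjugation by `U†`. -/
theorem conjAct_conjTranspose_mul_mul {m : Type*} [Fintype m] [DecidableEq m]
    {U : Matrix m m ℂ} (hU : U ∈ Matrix.unitaryGroup m ℂ) (ρ : Matrix m m ℂ) :
    conjAct U (Uᴴ * ρ * U) = ρ := by
  have h : U * Uᴴ = 1 := Matrix.mem_unitaryGroup_iff.mp hU
  calc U * (Uᴴ * ρ * U) * Uᴴ = (U * Uᴴ) * ρ * (U * Uᴴ) := by simp only [Matrix.mul_assoc]
    _ = ρ := by rw [h, Matrix.one_mul, Matrix.mul_one]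

/-- Gauge invariance of all experiments: the gauge transformation
`Λ_S ↦ D∘Λ_S`, `Λ_M ↦ Λ_M∘D⁻¹`, `Λ_t ↦ (𝒢_t⁻¹∘D∘𝒢_t)∘Λ_t∘D⁻¹` (with `D` an invertible
Pauli-diagonal map commuting with every single-qubit layer `𝒰_t`) preserves every
experimental expectation value `tr(O·Λ_M(𝒢_T(Λ_T(𝒰_T(⋯𝒢_1(Λ_1(𝒰_1(Λ_S(ρ₀))))⋯)))))`. -/
theorem gauge_invariance_of_experiments (n T : ℕ)
    (cS cM : (Fin n → Fin 4) → ℂ) (ct : Fin T → (Fin n → Fin 4) → ℂ)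
    (d dinv : (Fin n → Fin 4) → ℂ)
    (hd : ∀ ρ, pauliDiag n d (pauliDiag n dinv ρ) = ρ)
    (hd' : ∀ ρ, pauliDiag n dinv (pauliDiag n d ρ) = ρ)
    (G U : Fin T → Matrix (Fin n → Fin 2) (Fin n → Fin 2) ℂ)
    (hG : ∀ t, G t ∈ Matrix.unitaryGroup (Fin n → Fin 2) ℂ)
    (hU : ∀ t, U t ∈ Matrix.unitaryGroup (Fin n → Fin 2) ℂ)
    (hcomm : ∀ t ρ, pauliDiag n d (conjAct (U t) ρ) = conjAct (U t) (pauliDiag n d ρ))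
    (O ρ₀ : Matrix (Fin n → Fin 2) (Fin n → Fin 2) ℂ) :
    Matrix.trace (O * pauliDiag n cM (pauliDiag n dinv
        (runCirc T (fun t ρ => conjAct (G t)
            ((G t)ᴴ * pauliDiag n d (conjAct (G t)
                (pauliDiag n (ct t) (pauliDiag n dinv (conjAct (U t) ρ)))) * G t))
          (pauliDiag n d (pauliDiag n cS ρ₀))))) =
    Matrix.trace (O * pauliDiag n cM
        (runCirc T (fun t ρ => conjAct (G t) (pauliDiag n (ct t) (conjAct (U t) ρ)))
          (pauliDiag n cS ρ₀))) := by
  rw [runCirc_semiconj T (pauliDiag n d)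
    (fun t ρ => conjAct (G t) (pauliDiag n (ct t) (conjAct (U t) ρ))), hd']
  intro t ρ
  rw [conjAct_conjTranspose_mul_mul (hG t), ← hcomm, hd']

end
end
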